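/- Let S(t) be the free Schrödinger group on R^n and define the trilinear form T(v_1,v_2,v_3)(τ) = S(-τ)[ (S(-τ)v_1) (S(τ)v_2) (S(τ)v_3) ]. Then for all τ > 0, ‖T(v_1,v_2,v_3)(τ)‖_{L^1(R^n)} ≤ C τ^{-n} ‖v_1‖_{L^1(R^n)} ‖v_2‖_{L^1(R^n)} ‖v_3‖_{L^1(R^n)}, where C depends only on n. -/

import Mathlib

open MeasureTheory Complex

noncomputable def schrodingerS (n : ℕ) (t : ℝ) (f : EuclideanSpace ℝ (Fin n) → ℂ) :
    EuclideanSpace ℝ (Fin n) → ℂ :=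
  if t = 0 then f else fun x =>
    (-4 * (Real.pi : ℂ) * Complex.I * (t : ℂ)) ^ (-(n : ℂ) / 2) *
      ∫ y : EuclideanSpace ℝ (Fin n),
        Complex.exp (-Complex.I * ((‖x - y‖ : ℝ) ^ 2 : ℂ) / (4 * (t : ℂ))) * f y

open scoped FourierTransform ContDiff RealInnerProductSpace Convolution

section FourierL1

variable {V : Type*} [NormedAddCommGroup V] [InnerProductSpace ℝ V] [FiniteDimensional ℝ V]
  [MeasurableSpace V] [BorelSpace V]

theorem integral_fourier_smul_eq_of_integrable {f g : V → ℂ} (hf : Integrable f)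
    (hg : Integrable g) : ∫ ξ, 𝓕 f ξ • g ξ = ∫ x, f x • 𝓕 g x := by
  simpa using! VectorFourier.integral_fourierIntegral_smul_eq_flip (L := innerₗ V)
    Real.continuous_fourierChar continuous_inner hf hg

theorem integral_fourierInv_smul_eq_of_integrable {f g : V → ℂ} (hf : Integrable f)
    (hg : Integrable g) : ∫ ξ, 𝓕⁻ f ξ • g ξ = ∫ x, f x • 𝓕⁻ g x := by
  rw [Real.fourierInv_eq_fourier_comp_neg f, integral_fourier_smul_eq_of_integrable hf.comp_neg hg,
    ← integral_neg_eq_self]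
  simp [Real.fourierInv_eq_fourier_neg]

/-- Fourier inversion almost everywhere, for an integrable function with integrable transform. -/
theorem fourierInv_fourier_ae_eq {f : V → ℂ} (hf : Integrable f) (hF : Integrable (𝓕 f)) :
    𝓕⁻ (𝓕 f) =ᵐ[volume] f := by
  have hcont : Continuous (𝓕⁻ (𝓕 f)) := by
    rw [Real.fourierInv_eq_fourier_comp_neg]
    exact VectorFourier.fourierIntegral_continuous Real.continuous_fourierChar
      continuous_inner hF.comp_neg
  refine ae_eq_of_integral_contDiff_smul_eq hcont.locallyIntegrable hf.locallyIntegrable ?_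
  intro g hg hgc
  have hg₁ : HasCompactSupport (Complex.ofRealCLM ∘ g) := hgc.comp_left rfl
  have hg₂ : ContDiff ℝ ∞ (Complex.ofRealCLM ∘ g) := by fun_prop
  let ψ : SchwartzMap V ℂ := hg₁.toSchwartzMap hg₂
  have hψ (x : V) : ψ x = (g x : ℂ) := rfl
  have key : ∫ x, ψ x • 𝓕⁻ (𝓕 f) x = ∫ x, ψ x • f x := by
    rw [← integral_fourierInv_smul_eq_of_integrable ψ.integrable hF,
      ← SchwartzMap.fourierInv_coe,
      ← integral_fourier_smul_eq_of_integrable (𝓕⁻ ψ).integrable hf, ← SchwartzMap.fourier_coe,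
      FourierTransform.fourier_fourierInv_eq]
  simpa [hψ] using key

theorem eLpNorm_fourier_fourier_le {f : V → ℂ} (hf : Integrable f) :
    eLpNorm (𝓕 (𝓕 f)) 1 volume ≤ eLpNorm f 1 volume := by
  by_cases hF : Integrable (𝓕 f)
  · have h : 𝓕 (𝓕 f) = 𝓕⁻ (𝓕 f) ∘ (fun x : V => -x) := by
      ext x
      simp [Real.fourierInv_eq_fourier_neg]
    have hneg := Measure.measurePreserving_neg (volume : Measure V)
    rw [h, eLpNorm_congr_ae (hneg.quasiMeasurePreserving.ae_eq_comp
      (fourierInv_fourier_ae_eq hf hF)), eLpNorm_comp_measurePreserving hf.1 hneg]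
  · have h : 𝓕 (𝓕 f) = 0 := by
      ext x
      rw [Real.fourier_eq]
      exact integral_undef fun h => hF ((Real.fourierIntegral_convergent_iff x).1 h)
    simp [h]

theorem eLpNorm_one_convolution_mul_le {f g : V → ℂ} (hf : Integrable f) (hg : Integrable g) :
    eLpNorm (f ⋆[ContinuousLinearMap.mul ℂ ℂ] g) 1 volume
      ≤ eLpNorm f 1 volume * eLpNorm g 1 volume := by
  simp only [eLpNorm_one_eq_lintegral_enorm]
  calc ∫⁻ x, ‖(f ⋆[ContinuousLinearMap.mul ℂ ℂ] g) x‖ₑ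
      ≤ ∫⁻ x, ∫⁻ t, ‖f t‖ₑ * ‖g (x - t)‖ₑ := by
        refine lintegral_mono fun x => ?_
        rw [convolution_def]
        refine (enorm_integral_le_lintegral_enorm _).trans_eq ?_
        simp [enorm_mul]
    _ = ∫⁻ t, ∫⁻ x, ‖f t‖ₑ * ‖g (x - t)‖ₑ := by
        refine lintegral_lintegral_swap ?_
        have := (hf.convolution_integrand (ContinuousLinearMap.mul ℂ ℂ) hg).1.enorm
        simpa [Function.uncurry_def, enorm_mul] using this
    _ = ∫⁻ t, ‖f t‖ₑ * ∫⁻ x, ‖g x‖ₑ := by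
        refine lintegral_congr fun t => ?_
        rw [lintegral_const_mul' _ _ enorm_ne_top,
          lintegral_sub_right_eq_self (fun x => ‖g x‖ₑ) t]
    _ = _ := lintegral_mul_const'' _ hf.1.enorm

theorem fourier_comp_smul_apply_smul (h : V → ℂ) (a : ℝ) (x : V) :
    𝓕 (fun y => h (a • y)) (a • x) =
      ((|(a ^ Module.finrank ℝ V)⁻¹| : ℝ) : ℂ) * 𝓕 h x := by
  have := Measure.integral_comp_smul (volume : Measure V)
    (fun y => 𝐞 (-⟪y, x⟫) • h y) a
  rw [Real.fourier_eq, Real.fourier_eq, ← Complex.real_smul, ← this]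
  simp only [inner_smul_left, inner_smul_right, RCLike.conj_to_real]

end FourierL1

section Schrodinger

variable {n : ℕ}

/-- The quadratic phase of the Schrödinger kernel at time `t`. -/
noncomputable def schrodingerPhase (t : ℝ) (x : EuclideanSpace ℝ (Fin n)) : ℂ :=
  Complex.exp (-Complex.I * ((‖x‖ : ℝ) ^ 2 : ℂ) / (4 * (t : ℂ)))

theorem schrodingerPhase_eq_exp_ofReal_mul_I (t : ℝ) (x : EuclideanSpace ℝ (Fin n)) :
    schrodingerPhase t x = Complex.exp ((-(‖x‖ ^ 2 / (4 * t)) : ℝ) * Complex.I) := by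
  rw [schrodingerPhase]
  push_cast
  ring_nf

theorem norm_schrodingerPhase (t : ℝ) (x : EuclideanSpace ℝ (Fin n)) :
    ‖schrodingerPhase t x‖ = 1 := by
  rw [schrodingerPhase_eq_exp_ofReal_mul_I, Complex.norm_exp_ofReal_mul_I]

theorem schrodingerPhase_neg_mul_self (t : ℝ) (x : EuclideanSpace ℝ (Fin n)) :
    schrodingerPhase (-t) x * schrodingerPhase t x = 1 := by
  rw [schrodingerPhase_eq_exp_ofReal_mul_I, schrodingerPhase_eq_exp_ofReal_mul_I,
    ← Complex.exp_add, ← Complex.exp_zero]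
  congr 1
  push_cast
  rw [mul_neg, div_neg]
  ring

theorem continuous_schrodingerPhase (t : ℝ) :
    Continuous (schrodingerPhase t : EuclideanSpace ℝ (Fin n) → ℂ) := by
  unfold schrodingerPhase
  fun_prop

theorem MeasureTheory.Integrable.schrodingerPhase_mul {f : EuclideanSpace ℝ (Fin n) → ℂ}
    (hf : Integrable f) (t : ℝ) : Integrable (fun x => schrodingerPhase t x * f x) :=
  hf.bdd_mul (c := 1) (continuous_schrodingerPhase t).aestronglyMeasurable
    (.of_forall fun x => (norm_schrodingerPhase t x).le)

theorem eLpNorm_schrodingerPhase_mul (f : EuclideanSpace ℝ (Fin n) → ℂ) (t : ℝ) :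
    eLpNorm (fun x => schrodingerPhase t x * f x) 1 volume = eLpNorm f 1 volume :=
  eLpNorm_congr_norm_ae (.of_forall fun x => by simp [norm_schrodingerPhase])

/-- The normalizing constant of the Schrödinger kernel at time `t`. -/
noncomputable def schrodingerConst (n : ℕ) (t : ℝ) : ℂ :=
  (-4 * (Real.pi : ℂ) * Complex.I * (t : ℂ)) ^ (-(n : ℂ) / 2)

theorem norm_schrodingerConst (t : ℝ) :
    ‖schrodingerConst n t‖ = (4 * Real.pi * |t|) ^ (-(n : ℝ) / 2) := by
  have h : (-(n : ℂ) / 2) = ((-(n : ℝ) / 2 : ℝ) : ℂ) := by push_cast; rfl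
  rw [schrodingerConst, h, Complex.norm_cpow_real]
  simp [abs_of_pos Real.pi_pos]

/-- The free propagator is a Fourier transform up to quadratic phases and a dilation. -/
theorem schrodingerS_eq_fourier {t : ℝ} (ht : t ≠ 0) (f : EuclideanSpace ℝ (Fin n) → ℂ)
    (x : EuclideanSpace ℝ (Fin n)) :
    schrodingerS n t f x = schrodingerConst n t * (schrodingerPhase t x *
      𝓕 (fun y => schrodingerPhase t y * f y) (-(4 * Real.pi * t)⁻¹ • x)) := by
  rw [schrodingerS, if_neg ht]
  rw [schrodingerConst, Real.fourier_eq', ← integral_const_mul (schrodingerPhase t x)]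
  congr 2
  ext y
  rw [smul_eq_mul, ← mul_assoc, ← mul_assoc, schrodingerPhase, schrodingerPhase,
    ← Complex.exp_add, ← Complex.exp_add]
  congr 2
  have hn : ((‖x - y‖ : ℝ) : ℂ) ^ 2 = (‖x‖ : ℂ) ^ 2 - 2 * (⟪y, x⟫ : ℝ) + (‖y‖ : ℂ) ^ 2 := by
    rw [real_inner_comm]
    exact_mod_cast norm_sub_sq_real x y
  have ht' : (t : ℂ) ≠ 0 := by exact_mod_cast ht
  have hpi : (Real.pi : ℂ) ≠ 0 := by exact_mod_cast Real.pi_ne_zero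
  rw [hn, inner_smul_right]
  push_cast
  field_simp
  ring

theorem fourier_comp_neg_apply (f : EuclideanSpace ℝ (Fin n) → ℂ)
    (x : EuclideanSpace ℝ (Fin n)) : 𝓕 (fun y => f (-y)) x = 𝓕 f (-x) := by
  rw [← Real.fourierInv_eq_fourier_comp_neg, Real.fourierInv_eq_fourier_neg]

theorem eLpNorm_comp_neg {f : EuclideanSpace ℝ (Fin n) → ℂ} (hf : Integrable f) :
    eLpNorm (fun y => f (-y)) 1 volume = eLpNorm f 1 volume :=
  eLpNorm_comp_measurePreserving hf.1 (Measure.measurePreserving_neg volume)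

theorem schrodingerS_neg_eq_fourier {t : ℝ} (ht : t ≠ 0) (f : EuclideanSpace ℝ (Fin n) → ℂ)
    (x : EuclideanSpace ℝ (Fin n)) :
    schrodingerS n (-t) f x = schrodingerConst n (-t) * (schrodingerPhase (-t) x *
      𝓕 (fun y => schrodingerPhase (-t) y * f y) ((4 * Real.pi * t)⁻¹ • x)) := by
  rw [schrodingerS_eq_fourier (neg_ne_zero.2 ht), mul_neg, inv_neg, neg_neg]

theorem schrodingerS_eq_fourier_comp_neg {t : ℝ} (ht : t ≠ 0)
    (f : EuclideanSpace ℝ (Fin n) → ℂ) (x : EuclideanSpace ℝ (Fin n)) :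
    schrodingerS n t f x = schrodingerConst n t * (schrodingerPhase t x *
      𝓕 (fun y => schrodingerPhase t (-y) * f (-y)) ((4 * Real.pi * t)⁻¹ • x)) := by
  rw [schrodingerS_eq_fourier ht, fourier_comp_neg_apply (fun y => schrodingerPhase t y * f y),
    neg_smul]

/-- The trilinear expression is a multiple of an iterated Fourier transform of a convolution. -/
theorem exists_norm_trilinear_eq {τ : ℝ} (hτ : 0 < τ)
    {v₁ v₂ v₃ : EuclideanSpace ℝ (Fin n) → ℂ} (h₁ : Integrable v₁) (h₂ : Integrable v₂)
    (h₃ : Integrable v₃) :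
    ∃ G : EuclideanSpace ℝ (Fin n) → ℂ, Integrable G ∧
      eLpNorm G 1 volume ≤ eLpNorm v₁ 1 volume * eLpNorm v₂ 1 volume * eLpNorm v₃ 1 volume ∧
      ∀ x, ‖schrodingerS n (-τ) (fun x => schrodingerS n (-τ) v₁ x * schrodingerS n τ v₂ x *
        schrodingerS n τ v₃ x) x‖ = ‖(4 * Real.pi * τ) ^ (-(n : ℝ)) • 𝓕 (𝓕 G) x‖ := by
  have hw₁ := h₁.schrodingerPhase_mul (-τ)
  have hw₂ := h₂.schrodingerPhase_mul τ
  have hw₃ := h₃.schrodingerPhase_mul τ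
  have hn₁ := eLpNorm_schrodingerPhase_mul v₁ (-τ)
  have hn₂ := (eLpNorm_comp_neg hw₂).trans (eLpNorm_schrodingerPhase_mul v₂ τ)
  have hn₃ := (eLpNorm_comp_neg hw₃).trans (eLpNorm_schrodingerPhase_mul v₃ τ)
  replace hw₂ := hw₂.comp_neg
  replace hw₃ := hw₃.comp_neg
  set w₁ := fun x => schrodingerPhase (-τ) x * v₁ x with hw₁_def
  set w₂ := fun x => schrodingerPhase τ (-x) * v₂ (-x) with hw₂_def
  set w₃ := fun x => schrodingerPhase τ (-x) * v₃ (-x) with hw₃_def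
  have hw₁₂ : Integrable (w₁ ⋆[ContinuousLinearMap.mul ℂ ℂ] w₂) :=
    hw₁.integrable_convolution _ hw₂
  set G := (w₁ ⋆[ContinuousLinearMap.mul ℂ ℂ] w₂) ⋆[ContinuousLinearMap.mul ℂ ℂ] w₃ with hG
  refine ⟨G, hw₁₂.integrable_convolution _ hw₃, ?_, fun x => ?_⟩
  · rw [← hn₁, ← hn₂, ← hn₃]
    exact (eLpNorm_one_convolution_mul_le hw₁₂ hw₃).trans
      (mul_le_mul_left (eLpNorm_one_convolution_mul_le hw₁ hw₂) _)
  have hpos : 0 < 4 * Real.pi * τ := by positivity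
  set k : ℂ := schrodingerConst n (-τ) * schrodingerConst n τ * schrodingerConst n τ with hk
  have hprod : (fun y => schrodingerPhase (-τ) y * (schrodingerS n (-τ) v₁ y *
      schrodingerS n τ v₂ y * schrodingerS n τ v₃ y)) =
      fun y => (fun z => k • 𝓕 G z) ((4 * Real.pi * τ)⁻¹ • y) := by
    ext y
    have hp := schrodingerPhase_neg_mul_self τ y
    have hFG : 𝓕 G ((4 * Real.pi * τ)⁻¹ • y) = 𝓕 w₁ ((4 * Real.pi * τ)⁻¹ • y) *
        𝓕 w₂ ((4 * Real.pi * τ)⁻¹ • y) * 𝓕 w₃ ((4 * Real.pi * τ)⁻¹ • y) := by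
      rw [hG, Real.fourier_mul_convolution_eq hw₁₂ hw₃, Real.fourier_mul_convolution_eq hw₁ hw₂]
    simp only [smul_eq_mul]
    rw [hFG, schrodingerS_neg_eq_fourier hτ.ne', schrodingerS_eq_fourier_comp_neg hτ.ne',
      schrodingerS_eq_fourier_comp_neg hτ.ne', ← hw₁_def, ← hw₂_def, ← hw₃_def, hk]
    linear_combination (schrodingerConst n (-τ) * schrodingerConst n τ * schrodingerConst n τ *
      𝓕 w₁ ((4 * Real.pi * τ)⁻¹ • y) * 𝓕 w₂ ((4 * Real.pi * τ)⁻¹ • y) *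
      𝓕 w₃ ((4 * Real.pi * τ)⁻¹ • y)) *
      (schrodingerPhase (-τ) y * schrodingerPhase τ y + 1) * hp
  have hsmul : 𝓕 (fun z => k • 𝓕 G z) x = k * 𝓕 (𝓕 G) x := by
    rw [Real.fourier_eq, Real.fourier_eq (𝓕 G), ← integral_const_mul]
    exact integral_congr_ae (.of_forall fun z => smul_comm _ k _)
  rw [schrodingerS_neg_eq_fourier hτ.ne', hprod,
    fourier_comp_smul_apply_smul (fun z => k • 𝓕 G z), hsmul, hk]
  simp only [norm_mul, norm_smul, norm_schrodingerPhase, norm_schrodingerConst, abs_neg,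
    abs_of_pos hτ, Complex.norm_real, Real.norm_eq_abs, abs_abs, finrank_euclideanSpace_fin]
  rw [abs_of_pos (by positivity : 0 < ((4 * Real.pi * τ)⁻¹ ^ n)⁻¹),
    abs_of_pos (Real.rpow_pos_of_pos hpos _), inv_pow, inv_inv, ← Real.rpow_natCast]
  have hsq : (4 * Real.pi * τ) ^ (-(n : ℝ) / 2) * (4 * Real.pi * τ) ^ (-(n : ℝ) / 2) =
      (4 * Real.pi * τ) ^ (-(n : ℝ)) := by
    rw [← Real.rpow_add hpos, add_halves]
  have hcancel : (4 * Real.pi * τ) ^ (-(n : ℝ)) * (4 * Real.pi * τ) ^ (n : ℝ) = 1 := by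
    rw [← Real.rpow_add hpos, neg_add_cancel, Real.rpow_zero]
  generalize (4 * Real.pi * τ) ^ (-(n : ℝ) / 2) = p at *
  generalize (4 * Real.pi * τ) ^ (-(n : ℝ)) = q at *
  generalize (4 * Real.pi * τ) ^ (n : ℝ) = r at *
  subst hsq
  linear_combination (p * p * ‖𝓕 (𝓕 G) x‖) * hcancel

end Schrodinger

/-- Trilinear dispersive bound: `‖S(-τ)[(S(-τ)v₁)(S(τ)v₂)(S(τ)v₃)]‖_{L¹} ≤ C τ^{-n} ∏ ‖vᵢ‖_{L¹}`. -/
theorem stmt1 (n : ℕ) :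
    ∃ C : ℝ, 0 < C ∧
      ∀ v₁ v₂ v₃ : EuclideanSpace ℝ (Fin n) → ℂ,
        Integrable v₁ → Integrable v₂ → Integrable v₃ →
        ∀ τ : ℝ, 0 < τ →
          eLpNorm (schrodingerS n (-τ)
              (fun x => schrodingerS n (-τ) v₁ x * schrodingerS n τ v₂ x *
                schrodingerS n τ v₃ x)) 1 volume
            ≤ ENNReal.ofReal (C * τ ^ (-(n : ℝ))) *
              (eLpNorm v₁ 1 volume * eLpNorm v₂ 1 volume * eLpNorm v₃ 1 volume) := by
  refine ⟨(4 * Real.pi) ^ (-(n : ℝ)), by positivity, fun v₁ v₂ v₃ h₁ h₂ h₃ τ hτ => ?_⟩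
  obtain ⟨G, hG, hGn, hS⟩ := exists_norm_trilinear_eq hτ h₁ h₂ h₃
  rw [eLpNorm_congr_norm_ae (.of_forall hS),
    ← Real.mul_rpow (by positivity) hτ.le]
  refine (eLpNorm_const_smul_le (c := (4 * Real.pi * τ) ^ (-(n : ℝ)))
    (f := 𝓕 (𝓕 G))).trans ?_
  rw [Real.enorm_of_nonneg (by positivity)]
  exact mul_le_mul_right ((eLpNorm_fourier_fourier_le hG).trans hGn) _
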